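/- arXiv:2602.14904 — 5 statements merged into one kernel-verified Lean document; each statement's English description precedes it below -/
import Mathlib

section
/- Let ρ := λ₁ ←α₁ λ₀ →α₂ λ₂ be a sequentiable span of computon morphisms and let λ₁ →β₁ λ₃ ←β₂ λ₂ be the cospan induced by the pushout of ρ. Then β₁(P₁⁺) ⊆ P₃⁺ and β₂(P₂⁻) ⊆ P₃⁻. -/
namespace Computons

/-- A computon (Definition 1 of the paper). -/
structure Computon : Type 1 where
  U : Type
  P : Type
  I : Type
  O : Type
  finU : Finite U
  finP : Finite P
  finI : Finite I
  finO : Finite O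
  neP : Nonempty P
  types : Finset ℕ
  B : Finset String
  sigma : O → U
  t : O → P
  tau : I → U
  s : I → P
  c : P → ℕ
  r : I → O
  f : O → String
  c_mem : ∀ p, c p ∈ types
  f_mem : ∀ o, f o ∈ B
  sigma_surj : Function.Surjective sigma
  tau_surj : Function.Surjective tau
  r_surj : Function.Surjective r
  zero_mem : 0 ∈ types
  tau_ctrl : ∀ u, ∃ i, c (s i) = 0 ∧ tau i = u
  sigma_ctrl : ∀ u, ∃ o, c (t o) = 0 ∧ sigma o = u
  sigma_r : ∀ i, sigma (r i) = tau i
  ctrl_inport : ∃ p, p ∉ Set.range t ∧ c p = 0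
  ctrl_outport : ∃ q, q ∉ Set.range s ∧ c q = 0

/-- Inports `P⁺ = P \ t(O)`. -/
def inports (A : Computon) : Set A.P := {p | p ∉ Set.range A.t}

/-- Outports `P⁻ = P \ s(I)`. -/
def outports (A : Computon) : Set A.P := {p | p ∉ Set.range A.s}

/-- `•p = σ(t⁻¹(p))`. -/
def preUnits (A : Computon) (p : A.P) : Set A.U := A.sigma '' (A.t ⁻¹' {p})

/-- `p• = τ(s⁻¹(p))`. -/
def postUnits (A : Computon) (p : A.P) : Set A.U := A.tau '' (A.s ⁻¹' {p})

/-- A computon morphism (Definition of the paper).  The Σ- and B-components are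
inclusions, hence represented by the subset conditions `typesSub`, `bSub` together
with the commutation equations `comm_c`, `comm_f`. -/
structure Hom (A B : Computon) where
  fU : A.U → B.U
  fP : A.P → B.P
  fI : A.I → B.I
  fO : A.O → B.O
  typesSub : A.types ⊆ B.types
  bSub : A.B ⊆ B.B
  comm_tau : ∀ i, B.tau (fI i) = fU (A.tau i)
  comm_sigma : ∀ o, B.sigma (fO o) = fU (A.sigma o)
  comm_s : ∀ i, B.s (fI i) = fP (A.s i)
  comm_t : ∀ o, B.t (fO o) = fP (A.t o)
  comm_c : ∀ p, B.c (fP p) = A.c p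
  comm_r : ∀ i, B.r (fI i) = fO (A.r i)
  comm_f : ∀ o, B.f (fO o) = A.f o
  boundary : ∀ p : A.P,
    ((preUnits B (fP p) \ fU '' preUnits A p).Nonempty ∨
     (postUnits B (fP p) \ fU '' postUnits A p).Nonempty) →
    p ∈ inports A ∪ outports A

/-- `ı(α)`. -/
def iVec {A B : Computon} (α : Hom A B) : Set A.P :=
  {p | (preUnits B (α.fP p) \ α.fU '' preUnits A p).Nonempty}

/-- `o(α)`. -/
def oVec {A B : Computon} (α : Hom A B) : Set A.P :=
  {p | (postUnits B (α.fP p) \ α.fU '' postUnits A p).Nonempty}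

/-- Computon monomorphism: all components injective (the Σ- and B-components,
being inclusions, are automatically injective). -/
def IsMono {A B : Computon} (α : Hom A B) : Prop :=
  Function.Injective α.fU ∧ Function.Injective α.fP ∧
  Function.Injective α.fI ∧ Function.Injective α.fO

/-- Trivial computon: `U = I = O = ∅`. -/
def IsTrivial (A : Computon) : Prop := IsEmpty A.U ∧ IsEmpty A.I ∧ IsEmpty A.O

/-- Primitive computon: `|U| = 1`, `|P| = |I| + |O|`, and `s`, `t` injective. -/
def IsPrimitive (A : Computon) : Prop :=
  Nat.card A.U = 1 ∧ Nat.card A.P = Nat.card A.I + Nat.card A.O ∧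
  Function.Injective A.s ∧ Function.Injective A.t

/-- A glue: a primitive computon all of whose ports have type `0`. -/
def IsGlue (A : Computon) : Prop := IsPrimitive A ∧ ∀ p, A.c p = 0

/-- `CompEq g f h` expresses that the composite `g ∘ f` equals `h`
(componentwise; the Σ- and B-components are inclusions, hence determined). -/
def CompEq {A B C : Computon} (g : Hom B C) (f : Hom A B) (h : Hom A C) : Prop :=
  g.fU ∘ f.fU = h.fU ∧ g.fP ∘ f.fP = h.fP ∧ g.fI ∘ f.fI = h.fI ∧ g.fO ∘ f.fO = h.fO

/-- Commutativity of a square `β₁ ∘ α₁ = β₂ ∘ α₂` (componentwise). -/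
def CommSq {A B C D : Computon} (α₁ : Hom A B) (α₂ : Hom A C)
    (β₁ : Hom B D) (β₂ : Hom C D) : Prop :=
  β₁.fU ∘ α₁.fU = β₂.fU ∘ α₂.fU ∧ β₁.fP ∘ α₁.fP = β₂.fP ∘ α₂.fP ∧
  β₁.fI ∘ α₁.fI = β₂.fI ∘ α₂.fI ∧ β₁.fO ∘ α₁.fO = β₂.fO ∘ α₂.fO

/-- `β₁`, `β₂` form a pushout cocone of the span `(α₁, α₂)` in the
category of computons (universal property). -/
def IsPushout {L0 L1 L2 L3 : Computon} (α₁ : Hom L0 L1) (α₂ : Hom L0 L2)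
    (β₁ : Hom L1 L3) (β₂ : Hom L2 L3) : Prop :=
  CommSq α₁ α₂ β₁ β₂ ∧
  ∀ (L4 : Computon) (γ₁ : Hom L1 L4) (γ₂ : Hom L2 L4), CommSq α₁ α₂ γ₁ γ₂ →
    ∃! δ : Hom L3 L4, CompEq δ β₁ γ₁ ∧ CompEq δ β₂ γ₂

/-- Pushable span. -/
def Pushable {L0 L1 L2 : Computon} (α₁ : Hom L0 L1) (α₂ : Hom L0 L2) : Prop :=
  (α₁.fP '' iVec α₂ ∪ α₁.fP '' oVec α₂ ⊆ inports L1 ∪ outports L1) ∧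
  (α₂.fP '' iVec α₁ ∪ α₂.fP '' oVec α₁ ⊆ inports L2 ∪ outports L2) ∧
  L0.types ⊆ L1.types ∩ L2.types ∧ L0.B ⊆ L1.B ∩ L2.B

/-- Sequentiable span. -/
def Sequentiable {L0 L1 L2 : Computon} (α₁ : Hom L0 L1) (α₂ : Hom L0 L2) : Prop :=
  IsTrivial L0 ∧ IsMono α₁ ∧ IsMono α₂ ∧
  Set.range α₁.fP ⊆ outports L1 ∧ Set.range α₂.fP ⊆ inports L2 ∧
  L0.types ⊆ L1.types ∩ L2.types ∧ L0.B ⊆ L1.B ∩ L2.B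

/-- The condition under which the pushout of a sequentiable span is a *total*
sequential computon: `α₁(P₀) = P₁⁻` and `α₂(P₀) = P₂⁺`. -/
def TotalSeq {L0 L1 L2 : Computon} (α₁ : Hom L0 L1) (α₂ : Hom L0 L2) : Prop :=
  Set.range α₁.fP = outports L1 ∧ Set.range α₂.fP = inports L2

/-- Isomorphism of computons: a computon morphism with a two-sided inverse. -/
def Isomorphic (A B : Computon) : Prop :=
  ∃ (φ : Hom A B) (ψ : Hom B A),
    ψ.fU ∘ φ.fU = id ∧ ψ.fP ∘ φ.fP = id ∧ ψ.fI ∘ φ.fI = id ∧ ψ.fO ∘ φ.fO = id ∧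
    φ.fU ∘ ψ.fU = id ∧ φ.fP ∘ ψ.fP = id ∧ φ.fI ∘ ψ.fI = id ∧ φ.fO ∘ ψ.fO = id

/-- In-marker: a monomorphism from a trivial computon whose P-image is exactly the inports. -/
def InMarker {L0 L1 : Computon} (α : Hom L0 L1) : Prop :=
  IsTrivial L0 ∧ IsMono α ∧ Set.range α.fP = inports L1

/-- Out-marker: a monomorphism from a trivial computon whose P-image is exactly the outports. -/
def OutMarker {L0 L1 : Computon} (α : Hom L0 L1) : Prop :=
  IsTrivial L0 ∧ IsMono α ∧ Set.range α.fP = outports L1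

/-- `β₁`, `β₂` exhibit their codomain as the componentwise coproduct `L1 + L2`:
the injections are monic, jointly surjective with disjoint images on every
component, and types/devices are unions. -/
def IsCoprodObj {L1 L2 C : Computon} (β₁ : Hom L1 C) (β₂ : Hom L2 C) : Prop :=
  IsMono β₁ ∧ IsMono β₂ ∧
  (∀ u, u ∈ Set.range β₁.fU ∨ u ∈ Set.range β₂.fU) ∧
  (∀ p, p ∈ Set.range β₁.fP ∨ p ∈ Set.range β₂.fP) ∧
  (∀ i, i ∈ Set.range β₁.fI ∨ i ∈ Set.range β₂.fI) ∧
  (∀ o, o ∈ Set.range β₁.fO ∨ o ∈ Set.range β₂.fO) ∧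
  Disjoint (Set.range β₁.fU) (Set.range β₂.fU) ∧
  Disjoint (Set.range β₁.fP) (Set.range β₂.fP) ∧
  Disjoint (Set.range β₁.fI) (Set.range β₂.fI) ∧
  Disjoint (Set.range β₁.fO) (Set.range β₂.fO) ∧
  C.types = L1.types ∪ L2.types ∧ C.B = L1.B ∪ L2.B

/-- `β₁`, `β₂` form a coproduct cocone in the category of computons
(universal property). -/
def IsCoproduct {L1 L2 C : Computon} (β₁ : Hom L1 C) (β₂ : Hom L2 C) : Prop :=
  ∀ (D : Computon) (γ₁ : Hom L1 D) (γ₂ : Hom L2 D),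
    ∃! δ : Hom C D, CompEq δ β₁ γ₁ ∧ CompEq δ β₂ γ₂

/-- Source vertex of an edge of the bipartite graph of a computon. -/
def edgeSrc (A : Computon) : A.I ⊕ A.O → A.U ⊕ A.P
  | Sum.inl i => Sum.inr (A.s i)
  | Sum.inr o => Sum.inl (A.sigma o)

/-- Target vertex of an edge of the bipartite graph of a computon. -/
def edgeTgt (A : Computon) : A.I ⊕ A.O → A.U ⊕ A.P
  | Sum.inl i => Sum.inl (A.tau i)
  | Sum.inr o => Sum.inr (A.t o)

/-- Connected computon: from every port in `P⁺ ∪ s(I)` there is a directed path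
of length ≥ 2 in the bipartite graph ending in an outport. -/
def Connected (A : Computon) : Prop :=
  ∀ p : A.P, p ∈ inports A ∪ Set.range A.s →
    ∃ (n : ℕ) (e : Fin (n + 2) → A.I ⊕ A.O),
      edgeSrc A (e 0) = Sum.inr p ∧
      (∀ k : Fin (n + 1), edgeTgt A (e k.castSucc) = edgeSrc A (e k.succ)) ∧
      ∃ q ∈ outports A, edgeTgt A (e (Fin.last (n + 1))) = Sum.inr q

/-- A finite set of ports receiving those of `L1` and `L2`, in which a port of `L1` is identified
with a port of `L2` only if the former is an outport and the latter is an inport. -/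
structure PortGluing (L1 L2 : Computon) : Type 1 where
  P : Type
  finP : Finite P
  j₁ : L1.P → P
  j₂ : L2.P → P
  c : P → ℕ
  inj₁ : Function.Injective j₁
  inj₂ : Function.Injective j₂
  c_j₁ : ∀ p, c (j₁ p) = L1.c p
  c_j₂ : ∀ p, c (j₂ p) = L2.c p
  cover : ∀ q, q ∈ Set.range j₁ ∨ q ∈ Set.range j₂
  outport_of_eq : ∀ {p₁ p₂}, j₁ p₁ = j₂ p₂ → p₁ ∈ outports L1
  inport_of_eq : ∀ {p₁ p₂}, j₁ p₁ = j₂ p₂ → p₂ ∈ inports L2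

namespace PortGluing

variable {L1 L2 : Computon} (G : PortGluing L1 L2)

lemma j₁_notMem_range {p : L1.P} (hp : p ∈ inports L1) :
    G.j₁ p ∉ Set.range (Sum.elim (G.j₁ ∘ L1.t) (G.j₂ ∘ L2.t)) := by
  rintro ⟨o | o, ho⟩
  · exact hp ⟨o, G.inj₁ ho⟩
  · exact G.inport_of_eq ho.symm ⟨o, rfl⟩

lemma j₂_notMem_range {p : L2.P} (hp : p ∈ outports L2) :
    G.j₂ p ∉ Set.range (Sum.elim (G.j₁ ∘ L1.s) (G.j₂ ∘ L2.s)) := by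
  rintro ⟨i | i, hi⟩
  · exact G.outport_of_eq hi ⟨i, rfl⟩
  · exact hp ⟨i, G.inj₂ hi⟩

/-- The computon obtained from the disjoint union of `L1` and `L2` by gluing ports. -/
def computon : Computon where
  U := L1.U ⊕ L2.U
  P := G.P
  I := L1.I ⊕ L2.I
  O := L1.O ⊕ L2.O
  finU := by have := L1.finU; have := L2.finU; infer_instance
  finP := G.finP
  finI := by have := L1.finI; have := L2.finI; infer_instance
  finO := by have := L1.finO; have := L2.finO; infer_instance
  neP := L1.neP.map G.j₁
  types := L1.types ∪ L2.types
  B := L1.B ∪ L2.B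
  sigma := Sum.map L1.sigma L2.sigma
  t := Sum.elim (G.j₁ ∘ L1.t) (G.j₂ ∘ L2.t)
  tau := Sum.map L1.tau L2.tau
  s := Sum.elim (G.j₁ ∘ L1.s) (G.j₂ ∘ L2.s)
  c := G.c
  r := Sum.map L1.r L2.r
  f := Sum.elim L1.f L2.f
  c_mem q := by
    obtain ⟨p, rfl⟩ | ⟨p, rfl⟩ := G.cover q
    · rw [G.c_j₁]
      exact Finset.mem_union_left _ (L1.c_mem p)
    · rw [G.c_j₂]
      exact Finset.mem_union_right _ (L2.c_mem p)
  f_mem := by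
    rintro (o | o)
    · exact Finset.mem_union_left _ (L1.f_mem o)
    · exact Finset.mem_union_right _ (L2.f_mem o)
  sigma_surj := L1.sigma_surj.sumMap L2.sigma_surj
  tau_surj := L1.tau_surj.sumMap L2.tau_surj
  r_surj := L1.r_surj.sumMap L2.r_surj
  zero_mem := Finset.mem_union_left _ L1.zero_mem
  tau_ctrl := by
    rintro (u | u)
    · obtain ⟨i, hi, rfl⟩ := L1.tau_ctrl u
      exact ⟨.inl i, (G.c_j₁ _).trans hi, rfl⟩
    · obtain ⟨i, hi, rfl⟩ := L2.tau_ctrl u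
      exact ⟨.inr i, (G.c_j₂ _).trans hi, rfl⟩
  sigma_ctrl := by
    rintro (u | u)
    · obtain ⟨o, ho, rfl⟩ := L1.sigma_ctrl u
      exact ⟨.inl o, (G.c_j₁ _).trans ho, rfl⟩
    · obtain ⟨o, ho, rfl⟩ := L2.sigma_ctrl u
      exact ⟨.inr o, (G.c_j₂ _).trans ho, rfl⟩
  sigma_r := by
    rintro (i | i)
    · exact congrArg Sum.inl (L1.sigma_r i)
    · exact congrArg Sum.inr (L2.sigma_r i)
  ctrl_inport := by
    obtain ⟨p, hp, hc⟩ := L1.ctrl_inport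
    exact ⟨G.j₁ p, G.j₁_notMem_range hp, (G.c_j₁ p).trans hc⟩
  ctrl_outport := by
    obtain ⟨p, hp, hc⟩ := L2.ctrl_outport
    exact ⟨G.j₂ p, G.j₂_notMem_range hp, (G.c_j₂ p).trans hc⟩

/-- The inclusion of the first computon into the glued one. -/
def inlHom : Hom L1 G.computon where
  fU := Sum.inl
  fP := G.j₁
  fI := Sum.inl
  fO := Sum.inl
  typesSub := Finset.subset_union_left
  bSub := Finset.subset_union_left
  comm_tau _ := rfl
  comm_sigma _ := rfl
  comm_s _ := rfl
  comm_t _ := rfl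
  comm_c := G.c_j₁
  comm_r _ := rfl
  comm_f _ := rfl
  boundary p := by
    rintro (⟨_, ⟨o | o, ho, rfl⟩, hu⟩ | ⟨_, ⟨i | i, hi, rfl⟩, hu⟩)
    · exact absurd ⟨_, ⟨o, G.inj₁ ho, rfl⟩, rfl⟩ hu
    · exact .inr (G.outport_of_eq (Eq.symm ho))
    · exact absurd ⟨_, ⟨i, G.inj₁ hi, rfl⟩, rfl⟩ hu
    · exact .inr (G.outport_of_eq (Eq.symm hi))

/-- The inclusion of the second computon into the glued one. -/
def inrHom : Hom L2 G.computon where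
  fU := Sum.inr
  fP := G.j₂
  fI := Sum.inr
  fO := Sum.inr
  typesSub := Finset.subset_union_right
  bSub := Finset.subset_union_right
  comm_tau _ := rfl
  comm_sigma _ := rfl
  comm_s _ := rfl
  comm_t _ := rfl
  comm_c := G.c_j₂
  comm_r _ := rfl
  comm_f _ := rfl
  boundary p := by
    rintro (⟨_, ⟨o | o, ho, rfl⟩, hu⟩ | ⟨_, ⟨i | i, hi, rfl⟩, hu⟩)
    · exact .inl (G.inport_of_eq ho)
    · exact absurd ⟨_, ⟨o, G.inj₂ ho, rfl⟩, rfl⟩ hu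
    · exact .inl (G.inport_of_eq hi)
    · exact absurd ⟨_, ⟨i, G.inj₂ hi, rfl⟩, rfl⟩ hu

end PortGluing

/-- Gluing ports along a sequentiable span. -/
lemma Sequentiable.exists_portGluing {L0 L1 L2 : Computon} {α₁ : Hom L0 L1} {α₂ : Hom L0 L2}
    (h : Sequentiable α₁ α₂) :
    ∃ G : PortGluing L1 L2, G.j₁ ∘ α₁.fP = G.j₂ ∘ α₂.fP := by
  classical
  obtain ⟨-, ⟨-, inj₁, -⟩, ⟨-, inj₂, -⟩, hout, hin, -⟩ := h
  have := L1.finP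
  have := L2.finP
  let j₂ : L2.P → L1.P ⊕ {p : L2.P // p ∉ Set.range α₂.fP} := fun p =>
    if hp : p ∈ Set.range α₂.fP then .inl (α₁.fP hp.choose) else .inr ⟨p, hp⟩
  have j₂_range (p : L0.P) : j₂ (α₂.fP p) = .inl (α₁.fP p) := by
    have hp : α₂.fP p ∈ Set.range α₂.fP := ⟨p, rfl⟩
    simp only [j₂, dif_pos hp, inj₂ hp.choose_spec]
  have j₂_of_notMem (p : L2.P) (hp : p ∉ Set.range α₂.fP) : j₂ p = .inr ⟨p, hp⟩ := dif_neg hp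
  have exists_of_eq {p₁ : L1.P} {p₂ : L2.P} (e : Sum.inl p₁ = j₂ p₂) :
      ∃ p, α₁.fP p = p₁ ∧ α₂.fP p = p₂ := by
    by_cases hp : p₂ ∈ Set.range α₂.fP
    · obtain ⟨p, rfl⟩ := hp
      rw [j₂_range] at e
      exact ⟨p, (Sum.inl.inj e).symm, rfl⟩
    · rw [j₂_of_notMem _ hp] at e
      cases e
  refine ⟨{
    P := L1.P ⊕ {p : L2.P // p ∉ Set.range α₂.fP}
    finP := inferInstance
    j₁ := Sum.inl
    j₂ := j₂
    c := Sum.elim L1.c (fun p => L2.c p)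
    inj₁ := Sum.inl_injective
    inj₂ := ?_
    c_j₁ := fun _ => rfl
    c_j₂ := ?_
    cover := ?_
    outport_of_eq := ?_
    inport_of_eq := ?_ }, funext fun p => (j₂_range p).symm⟩
  · intro p q e
    by_cases hp : p ∈ Set.range α₂.fP
    · obtain ⟨p, rfl⟩ := hp
      rw [j₂_range] at e
      obtain ⟨q, hq, rfl⟩ := exists_of_eq e
      rw [inj₁ hq]
    · by_cases hq : q ∈ Set.range α₂.fP
      · obtain ⟨q, rfl⟩ := hq
        rw [j₂_range, j₂_of_notMem _ hp] at e
        cases e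
      · rw [j₂_of_notMem _ hp, j₂_of_notMem _ hq] at e
        exact congrArg Subtype.val (Sum.inr.inj e)
  · intro p
    by_cases hp : p ∈ Set.range α₂.fP
    · obtain ⟨p, rfl⟩ := hp
      rw [j₂_range]
      exact (α₁.comm_c p).trans (α₂.comm_c p).symm
    · rw [j₂_of_notMem _ hp]
      rfl
  · rintro (p | p)
    · exact .inl ⟨p, rfl⟩
    · exact .inr ⟨p, j₂_of_notMem _ p.2⟩
  · intro _ _ e
    obtain ⟨p, rfl, -⟩ := exists_of_eq e
    exact hout ⟨p, rfl⟩
  · intro _ _ e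
    obtain ⟨p, -, rfl⟩ := exists_of_eq e
    exact hin ⟨p, rfl⟩

/-- For a sequentiable span with pushout-induced cospan
λ₁ →β₁ λ₃ ←β₂ λ₂, we have β₁(P₁⁺) ⊆ P₃⁺ and β₂(P₂⁻) ⊆ P₃⁻. -/
theorem sequential_interface (L0 L1 L2 L3 : Computon)
    (α₁ : Hom L0 L1) (α₂ : Hom L0 L2) (β₁ : Hom L1 L3) (β₂ : Hom L2 L3)
    (hseq : Sequentiable α₁ α₂) (hpo : IsPushout α₁ α₂ β₁ β₂) :
    β₁.fP '' inports L1 ⊆ inports L3 ∧ β₂.fP '' outports L2 ⊆ outports L3 := by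
  obtain ⟨G, hG⟩ := hseq.exists_portGluing
  obtain ⟨hU, hI, hO⟩ := hseq.1
  obtain ⟨δ, ⟨⟨-, h₁, -⟩, -, h₂, -⟩, -⟩ := hpo.2 G.computon G.inlHom G.inrHom
    ⟨funext fun u => (hU.false u).elim, hG, funext fun i => (hI.false i).elim,
      funext fun o => (hO.false o).elim⟩
  constructor
  · rintro _ ⟨p, hp, rfl⟩ ⟨o, ho⟩
    exact G.j₁_notMem_range hp
      ⟨δ.fO o, (δ.comm_t o).trans ((congrArg δ.fP ho).trans (congrFun h₁ p))⟩
  · rintro _ ⟨p, hp, rfl⟩ ⟨i, hi⟩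
    exact G.j₂_notMem_range hp
      ⟨δ.fI i, (δ.comm_s i).trans ((congrArg δ.fP hi).trans (congrFun h₂ p))⟩

end Computons
end

section
/- Sequencing satisfies identity up to isomorphism: let λ be a trivial computon with exactly one port (necessarily of type 0), Σ = {0} and B = ∅. Then for every computon λ₁ and every sequentiable span ρ₁ := λ ←α λ₀ →α₁ λ₁, the pushout of ρ₁ is isomorphic to λ₁; symmetrically, for every sequentiable span ρ₂ := λ₁ ← λ₀ → λ, the pushout of ρ₂ is isomorphic to λ₁. -/
namespace Computons

def Hom.id (A : Computon) : Hom A A where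
  fU := _root_.id
  fP := _root_.id
  fI := _root_.id
  fO := _root_.id
  typesSub := subset_rfl
  bSub := subset_rfl
  comm_tau _ := rfl
  comm_sigma _ := rfl
  comm_s _ := rfl
  comm_t _ := rfl
  comm_c _ := rfl
  comm_r _ := rfl
  comm_f _ := rfl
  boundary p hp := by simp at hp

/-- A morphism whose source port lies strictly inside the source computon hits
a port strictly inside the target computon. -/
theorem Hom.mem_boundary_of_map {A B : Computon} (α : Hom A B) {p : A.P}
    (hp : α.fP p ∈ inports B ∪ outports B) : p ∈ inports A ∪ outports A := by
  refine hp.imp ?_ ?_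
  · rintro h ⟨o, rfl⟩
    exact h ⟨α.fO o, α.comm_t o⟩
  · rintro h ⟨i, rfl⟩
    exact h ⟨α.fI i, α.comm_s i⟩

theorem nonempty_diff_image_comp {X Y Z : Type*} {f : X → Y} {g : Y → Z}
    {R : Set X} {S : Set Y} {T : Set Z} (h : (T \ (g ∘ f) '' R).Nonempty) :
    (T \ g '' S).Nonempty ∨ (S \ f '' R).Nonempty := by
  obtain ⟨z, hz, hzR⟩ := h
  by_cases hzS : z ∈ g '' S
  · obtain ⟨y, hy, rfl⟩ := hzS
    refine .inr ⟨y, hy, ?_⟩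
    rintro ⟨x, hx, rfl⟩
    exact hzR ⟨x, hx, rfl⟩
  · exact .inl ⟨z, hz, hzS⟩

def Hom.comp {A B C : Computon} (g : Hom B C) (f : Hom A B) : Hom A C where
  fU := g.fU ∘ f.fU
  fP := g.fP ∘ f.fP
  fI := g.fI ∘ f.fI
  fO := g.fO ∘ f.fO
  typesSub := f.typesSub.trans g.typesSub
  bSub := f.bSub.trans g.bSub
  comm_tau i := by simp [g.comm_tau, f.comm_tau]
  comm_sigma o := by simp [g.comm_sigma, f.comm_sigma]
  comm_s i := by simp [g.comm_s, f.comm_s]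
  comm_t o := by simp [g.comm_t, f.comm_t]
  comm_c p := by simp [g.comm_c, f.comm_c]
  comm_r i := by simp [g.comm_r, f.comm_r]
  comm_f o := by simp [g.comm_f, f.comm_f]
  boundary p hp := by
    rcases hp with hp | hp
    · rcases nonempty_diff_image_comp (S := preUnits B (f.fP p)) hp with h | h
      · exact f.mem_boundary_of_map (g.boundary _ (.inl h))
      · exact f.boundary p (.inl h)
    · rcases nonempty_diff_image_comp (S := postUnits B (f.fP p)) hp with h | h
      · exact f.mem_boundary_of_map (g.boundary _ (.inr h))
      · exact f.boundary p (.inr h)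

theorem CommSq.symm {A B C D : Computon} {α₁ : Hom A B} {α₂ : Hom A C}
    {β₁ : Hom B D} {β₂ : Hom C D} (h : CommSq α₁ α₂ β₁ β₂) : CommSq α₂ α₁ β₂ β₁ :=
  ⟨h.1.symm, h.2.1.symm, h.2.2.1.symm, h.2.2.2.symm⟩

theorem IsPushout.symm {A B C D : Computon} {α₁ : Hom A B} {α₂ : Hom A C}
    {β₁ : Hom B D} {β₂ : Hom C D} (h : IsPushout α₁ α₂ β₁ β₂) : IsPushout α₂ α₁ β₂ β₁ := by
  refine ⟨h.1.symm, fun L γ₂ γ₁ hγ => ?_⟩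
  simpa only [and_comm] using h.2 L γ₁ γ₂ hγ.symm

/-- A pushout of `α₁` and `α₂` is isomorphic to the codomain of `α₂` as soon as `α₂`
factors through `α₁` by a morphism `ε` compatible with the pushout cocone. -/
theorem IsPushout.isomorphic_of_factor {A E L Q : Computon} {α₁ : Hom A E} {α₂ : Hom A L}
    {β₁ : Hom E Q} {β₂ : Hom L Q} (h : IsPushout α₁ α₂ β₁ β₂) (ε : Hom E L)
    (hε : CompEq ε α₁ α₂) (hβ : CompEq β₂ ε β₁) : Isomorphic Q L := by
  obtain ⟨δ, ⟨hδ₁, hδ₂⟩, -⟩ := h.2 L ε (Hom.id L) hε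
  have hid : CompEq (Hom.id Q) β₁ β₁ ∧ CompEq (Hom.id Q) β₂ β₂ :=
    ⟨⟨rfl, rfl, rfl, rfl⟩, ⟨rfl, rfl, rfl, rfl⟩⟩
  have hcomp : CompEq (β₂.comp δ) β₁ β₁ ∧ CompEq (β₂.comp δ) β₂ β₂ := by
    obtain ⟨a₁, a₂, a₃, a₄⟩ := hδ₁
    obtain ⟨b₁, b₂, b₃, b₄⟩ := hδ₂
    obtain ⟨c₁, c₂, c₃, c₄⟩ := hβ
    refine ⟨⟨?_, ?_, ?_, ?_⟩, ⟨?_, ?_, ?_, ?_⟩⟩ <;>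
      simp only [Hom.comp, Function.comp_assoc, *] <;> rfl
  have heq : β₂.comp δ = Hom.id Q := (h.2 Q β₁ β₂ h.1).unique hcomp hid
  exact ⟨δ, β₂, congrArg Hom.fU heq, congrArg Hom.fP heq, congrArg Hom.fI heq,
    congrArg Hom.fO heq, hδ₂.1, hδ₂.2.1, hδ₂.2.2.1, hδ₂.2.2.2⟩

def Hom.ofTrivial {E L : Computon} (hE : IsTrivial E) (g : E.P → L.P)
    (hc : ∀ p, L.c (g p) = E.c p) (hTypes : E.types ⊆ L.types) (hB : E.B ⊆ L.B) :
    Hom E L where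
  fU u := hE.1.elim u
  fP := g
  fI i := hE.2.1.elim i
  fO o := hE.2.2.elim o
  typesSub := hTypes
  bSub := hB
  comm_tau i := hE.2.1.elim i
  comm_sigma o := hE.2.2.elim o
  comm_s i := hE.2.1.elim i
  comm_t o := hE.2.2.elim o
  comm_c := hc
  comm_r i := hE.2.1.elim i
  comm_f o := hE.2.2.elim o
  boundary _ _ := .inl fun ⟨o, _⟩ => hE.2.2.elim o

theorem compEq_of_isTrivial {A B C : Computon} (hA : IsTrivial A) {g : Hom B C} {f : Hom A B}
    {h : Hom A C} (hP : g.fP ∘ f.fP = h.fP) : CompEq g f h :=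
  ⟨funext fun u => hA.1.elim u, hP, funext fun i => hA.2.1.elim i,
    funext fun o => hA.2.2.elim o⟩

theorem IsPushout.isomorphic_of_unit {E A L Q : Computon} (hE : IsTrivial E)
    (hP : Nat.card E.P = 1) (hTypes : E.types = {0}) (hB : E.B = ∅) (hA : IsTrivial A)
    {α : Hom A E} (hα : Function.Injective α.fP) {α₁ : Hom A L}
    {β₁ : Hom E Q} {β₂ : Hom L Q} (h : IsPushout α α₁ β₁ β₂) : Isomorphic Q L := by
  have hsub : Subsingleton E.P := (Nat.card_eq_one_iff_unique.mp hP).1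
  have hsubA : Subsingleton A.P := hα.subsingleton
  obtain ⟨p⟩ := A.neP
  refine h.isomorphic_of_factor
    (Hom.ofTrivial hE (fun _ => α₁.fP p) (fun q => ?_) ?_ ?_)
    (compEq_of_isTrivial hA (funext fun q => ?_)) (compEq_of_isTrivial hE (funext fun q => ?_))
  · rw [α₁.comm_c, ← α.comm_c, Subsingleton.elim q]
  · simpa [hTypes] using L.zero_mem
  · simp [hB]
  · exact congrArg α₁.fP (Subsingleton.elim p q)
  · rw [Subsingleton.elim q (α.fP p)]
    exact (congrFun h.1.2.1 p).symm

/-- Sequencing satisfies identity up to isomorphism: a trivial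
computon E with exactly one port, Σ = {0} and B = ∅ is a left- and
right-identity for (total and partial) sequencing. -/
theorem sequencing_identity (E : Computon)
    (hTriv : IsTrivial E) (hP : Nat.card E.P = 1)
    (hTypes : E.types = {0}) (hB : E.B = ∅) :
    ∀ (L1 : Computon),
      (∀ (L0 : Computon) (α : Hom L0 E) (α₁ : Hom L0 L1),
        Sequentiable α α₁ →
        ∀ (Q : Computon) (β₁ : Hom E Q) (β₂ : Hom L1 Q),
          IsPushout α α₁ β₁ β₂ → Isomorphic Q L1) ∧
      (∀ (L0 : Computon) (α₁ : Hom L0 L1) (α : Hom L0 E),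
        Sequentiable α₁ α →
        ∀ (Q : Computon) (β₁ : Hom L1 Q) (β₂ : Hom E Q),
          IsPushout α₁ α β₁ β₂ → Isomorphic Q L1) := by
  refine fun L1 => ⟨fun L0 α α₁ hs Q β₁ β₂ h => ?_, fun L0 α₁ α hs Q β₁ β₂ h => ?_⟩
  · exact h.isomorphic_of_unit hTriv hP hTypes hB hs.1 hs.2.1.2.1
  · exact h.symm.isomorphic_of_unit hTriv hP hTypes hB hs.1 hs.2.2.1.2.1

end Computons
end

section
/- For any two computons λ₁ and λ₂, the async computon λ₁ + λ₂ can always be constructed: the componentwise coproduct construction yields a valid computon (all the defining restrictions of a computon hold for it), and the canonical injections β₁: λ₁ → λ₁ + λ₂ and β₂: λ₂ → λ₁ + λ₂ are computon monomorphisms, exhibiting λ₁ + λ₂ as the coproduct of λ₁ and λ₂ in the category of computons. -/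
namespace Computons

theorem image_sumMap_preimage_inl {α α' β β' γ γ' : Type*} (g : α → β) (g' : α' → β')
    (h : α → γ) (h' : α' → γ') (x : γ) :
    Sum.map g g' '' (Sum.map h h' ⁻¹' {Sum.inl x}) = Sum.inl '' (g '' (h ⁻¹' {x})) := by
  ext (y | y) <;> simp

theorem image_sumMap_preimage_inr {α α' β β' γ γ' : Type*} (g : α → β) (g' : α' → β')
    (h : α → γ) (h' : α' → γ') (x : γ') :
    Sum.map g g' '' (Sum.map h h' ⁻¹' {Sum.inr x}) = Sum.inr '' (g' '' (h' ⁻¹' {x})) := by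
  ext (y | y) <;> simp

theorem inl_mem_range_sumMap {α α' β β' : Type*} (g : α → β) (g' : α' → β') (x : β) :
    Sum.inl x ∈ Set.range (Sum.map g g') ↔ x ∈ Set.range g := by
  simp

theorem inr_mem_range_sumMap {α α' β β' : Type*} (g : α → β) (g' : α' → β') (x : β') :
    Sum.inr x ∈ Set.range (Sum.map g g') ↔ x ∈ Set.range g' := by
  simp

/-- The componentwise coproduct of two computons. -/
def coprod (A B : Computon) : Computon where
  U := A.U ⊕ B.U
  P := A.P ⊕ B.P
  I := A.I ⊕ B.I
  O := A.O ⊕ B.O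
  finU := have := A.finU; have := B.finU; inferInstance
  finP := have := A.finP; have := B.finP; inferInstance
  finI := have := A.finI; have := B.finI; inferInstance
  finO := have := A.finO; have := B.finO; inferInstance
  neP := have := A.neP; inferInstance
  types := A.types ∪ B.types
  B := A.B ∪ B.B
  sigma := Sum.map A.sigma B.sigma
  t := Sum.map A.t B.t
  tau := Sum.map A.tau B.tau
  s := Sum.map A.s B.s
  c := Sum.elim A.c B.c
  r := Sum.map A.r B.r
  f := Sum.elim A.f B.f
  c_mem := by
    rintro (p | p)
    · exact Finset.mem_union_left _ (A.c_mem p)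
    · exact Finset.mem_union_right _ (B.c_mem p)
  f_mem := by
    rintro (o | o)
    · exact Finset.mem_union_left _ (A.f_mem o)
    · exact Finset.mem_union_right _ (B.f_mem o)
  sigma_surj := A.sigma_surj.sumMap B.sigma_surj
  tau_surj := A.tau_surj.sumMap B.tau_surj
  r_surj := A.r_surj.sumMap B.r_surj
  zero_mem := Finset.mem_union_left _ A.zero_mem
  tau_ctrl := by
    rintro (u | u)
    · obtain ⟨i, hi, rfl⟩ := A.tau_ctrl u
      exact ⟨Sum.inl i, hi, rfl⟩
    · obtain ⟨i, hi, rfl⟩ := B.tau_ctrl u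
      exact ⟨Sum.inr i, hi, rfl⟩
  sigma_ctrl := by
    rintro (u | u)
    · obtain ⟨o, ho, rfl⟩ := A.sigma_ctrl u
      exact ⟨Sum.inl o, ho, rfl⟩
    · obtain ⟨o, ho, rfl⟩ := B.sigma_ctrl u
      exact ⟨Sum.inr o, ho, rfl⟩
  sigma_r := by
    rintro (i | i)
    · exact congrArg Sum.inl (A.sigma_r i)
    · exact congrArg Sum.inr (B.sigma_r i)
  ctrl_inport := by
    obtain ⟨p, hp, hc⟩ := A.ctrl_inport
    exact ⟨Sum.inl p, by simpa using hp, hc⟩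
  ctrl_outport := by
    obtain ⟨q, hq, hc⟩ := A.ctrl_outport
    exact ⟨Sum.inl q, by simpa using hq, hc⟩

theorem preUnits_coprod_inl (A B : Computon) (p : A.P) :
    preUnits (coprod A B) (Sum.inl p) = Sum.inl '' preUnits A p :=
  image_sumMap_preimage_inl A.sigma B.sigma A.t B.t p

theorem preUnits_coprod_inr (A B : Computon) (p : B.P) :
    preUnits (coprod A B) (Sum.inr p) = Sum.inr '' preUnits B p :=
  image_sumMap_preimage_inr A.sigma B.sigma A.t B.t p

theorem postUnits_coprod_inl (A B : Computon) (p : A.P) :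
    postUnits (coprod A B) (Sum.inl p) = Sum.inl '' postUnits A p :=
  image_sumMap_preimage_inl A.tau B.tau A.s B.s p

theorem postUnits_coprod_inr (A B : Computon) (p : B.P) :
    postUnits (coprod A B) (Sum.inr p) = Sum.inr '' postUnits B p :=
  image_sumMap_preimage_inr A.tau B.tau A.s B.s p

theorem inl_mem_boundary_coprod {A B : Computon} {p : A.P} (hp : p ∈ inports A ∪ outports A) :
    Sum.inl p ∈ inports (coprod A B) ∪ outports (coprod A B) :=
  hp.imp (mt (inl_mem_range_sumMap A.t B.t p).1) (mt (inl_mem_range_sumMap A.s B.s p).1)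

theorem inr_mem_boundary_coprod {A B : Computon} {p : B.P} (hp : p ∈ inports B ∪ outports B) :
    Sum.inr p ∈ inports (coprod A B) ∪ outports (coprod A B) :=
  hp.imp (mt (inr_mem_range_sumMap A.t B.t p).1) (mt (inr_mem_range_sumMap A.s B.s p).1)

/-- The left canonical injection. -/
def coprodInl (A B : Computon) : Hom A (coprod A B) where
  fU := Sum.inl
  fP := Sum.inl
  fI := Sum.inl
  fO := Sum.inl
  typesSub := Finset.subset_union_left
  bSub := Finset.subset_union_left
  comm_tau _ := rfl
  comm_sigma _ := rfl
  comm_s _ := rfl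
  comm_t _ := rfl
  comm_c _ := rfl
  comm_r _ := rfl
  comm_f _ := rfl
  boundary p h := by
    obtain ⟨u, hu, hn⟩ | ⟨u, hu, hn⟩ := h
    · exact absurd ((preUnits_coprod_inl A B p).le hu) hn
    · exact absurd ((postUnits_coprod_inl A B p).le hu) hn

/-- The right canonical injection. -/
def coprodInr (A B : Computon) : Hom B (coprod A B) where
  fU := Sum.inr
  fP := Sum.inr
  fI := Sum.inr
  fO := Sum.inr
  typesSub := Finset.subset_union_right
  bSub := Finset.subset_union_right
  comm_tau _ := rfl
  comm_sigma _ := rfl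
  comm_s _ := rfl
  comm_t _ := rfl
  comm_c _ := rfl
  comm_r _ := rfl
  comm_f _ := rfl
  boundary p h := by
    obtain ⟨u, hu, hn⟩ | ⟨u, hu, hn⟩ := h
    · exact absurd ((preUnits_coprod_inr A B p).le hu) hn
    · exact absurd ((postUnits_coprod_inr A B p).le hu) hn

/-- The copairing of two morphisms with common codomain. -/
def coprodDesc {A B D : Computon} (γ₁ : Hom A D) (γ₂ : Hom B D) : Hom (coprod A B) D where
  fU := Sum.elim γ₁.fU γ₂.fU
  fP := Sum.elim γ₁.fP γ₂.fP
  fI := Sum.elim γ₁.fI γ₂.fI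
  fO := Sum.elim γ₁.fO γ₂.fO
  typesSub := Finset.union_subset γ₁.typesSub γ₂.typesSub
  bSub := Finset.union_subset γ₁.bSub γ₂.bSub
  comm_tau := Sum.rec γ₁.comm_tau γ₂.comm_tau
  comm_sigma := Sum.rec γ₁.comm_sigma γ₂.comm_sigma
  comm_s := Sum.rec γ₁.comm_s γ₂.comm_s
  comm_t := Sum.rec γ₁.comm_t γ₂.comm_t
  comm_c := Sum.rec γ₁.comm_c γ₂.comm_c
  comm_r := Sum.rec γ₁.comm_r γ₂.comm_r
  comm_f := Sum.rec γ₁.comm_f γ₂.comm_f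
  boundary := by
    rintro (p | p) h
    · refine inl_mem_boundary_coprod (γ₁.boundary p (h.imp ?_ ?_))
      · rintro ⟨u, hu, hn⟩
        refine ⟨u, hu, fun ⟨v, hv, e⟩ => hn ⟨Sum.inl v, ?_, e⟩⟩
        exact (preUnits_coprod_inl A B p).ge ⟨v, hv, rfl⟩
      · rintro ⟨u, hu, hn⟩
        refine ⟨u, hu, fun ⟨v, hv, e⟩ => hn ⟨Sum.inl v, ?_, e⟩⟩
        exact (postUnits_coprod_inl A B p).ge ⟨v, hv, rfl⟩
    · refine inr_mem_boundary_coprod (γ₂.boundary p (h.imp ?_ ?_))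
      · rintro ⟨u, hu, hn⟩
        refine ⟨u, hu, fun ⟨v, hv, e⟩ => hn ⟨Sum.inr v, ?_, e⟩⟩
        exact (preUnits_coprod_inr A B p).ge ⟨v, hv, rfl⟩
      · rintro ⟨u, hu, hn⟩
        refine ⟨u, hu, fun ⟨v, hv, e⟩ => hn ⟨Sum.inr v, ?_, e⟩⟩
        exact (postUnits_coprod_inr A B p).ge ⟨v, hv, rfl⟩

theorem Hom.ext_components {A B : Computon} {α β : Hom A B} (hU : α.fU = β.fU)
    (hP : α.fP = β.fP) (hI : α.fI = β.fI) (hO : α.fO = β.fO) : α = β := by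
  cases α
  cases β
  cases hU
  cases hP
  cases hI
  cases hO
  rfl

theorem isMono_coprodInl (A B : Computon) : IsMono (coprodInl A B) :=
  ⟨Sum.inl_injective, Sum.inl_injective, Sum.inl_injective, Sum.inl_injective⟩

theorem isMono_coprodInr (A B : Computon) : IsMono (coprodInr A B) :=
  ⟨Sum.inr_injective, Sum.inr_injective, Sum.inr_injective, Sum.inr_injective⟩

theorem mem_range_inl_or_mem_range_inr {α β : Type*} (x : α ⊕ β) :
    x ∈ Set.range (Sum.inl : α → α ⊕ β) ∨ x ∈ Set.range (Sum.inr : β → α ⊕ β) := by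
  cases x <;> simp

theorem isCoprodObj_coprod (A B : Computon) : IsCoprodObj (coprodInl A B) (coprodInr A B) :=
  ⟨isMono_coprodInl A B, isMono_coprodInr A B,
    mem_range_inl_or_mem_range_inr, mem_range_inl_or_mem_range_inr,
    mem_range_inl_or_mem_range_inr, mem_range_inl_or_mem_range_inr,
    Set.isCompl_range_inl_range_inr.disjoint, Set.isCompl_range_inl_range_inr.disjoint,
    Set.isCompl_range_inl_range_inr.disjoint, Set.isCompl_range_inl_range_inr.disjoint,
    rfl, rfl⟩

theorem isCoproduct_coprod (A B : Computon) : IsCoproduct (coprodInl A B) (coprodInr A B) := by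
  intro D γ₁ γ₂
  refine ⟨coprodDesc γ₁ γ₂, ⟨⟨rfl, rfl, rfl, rfl⟩, ⟨rfl, rfl, rfl, rfl⟩⟩, ?_⟩
  rintro δ ⟨⟨hU₁, hP₁, hI₁, hO₁⟩, ⟨hU₂, hP₂, hI₂, hO₂⟩⟩
  exact Hom.ext_components
    (funext (Sum.rec (congrFun hU₁) (congrFun hU₂)))
    (funext (Sum.rec (congrFun hP₁) (congrFun hP₂)))
    (funext (Sum.rec (congrFun hI₁) (congrFun hI₂)))
    (funext (Sum.rec (congrFun hO₁) (congrFun hO₂)))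

/-- For any two computons λ₁ and λ₂ the async computon λ₁ + λ₂
can always be constructed: there is a valid computon with monic canonical
injections, componentwise a coproduct, which is a coproduct in the category of
computons. -/
theorem async_always_exists (L1 L2 : Computon) :
    ∃ (C : Computon) (β₁ : Hom L1 C) (β₂ : Hom L2 C),
      IsCoprodObj β₁ β₂ ∧ IsMono β₁ ∧ IsMono β₂ ∧ IsCoproduct β₁ β₂ := by
  exact ⟨coprod L1 L2, coprodInl L1 L2, coprodInr L1 L2, isCoprodObj_coprod L1 L2,
    isMono_coprodInl L1 L2, isMono_coprodInr L1 L2, isCoproduct_coprod L1 L2⟩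

end Computons
end

section
/- Asynchronous parallelising does not satisfy the identity law: for all computons λ and λ₁, the coproduct λ + λ₁ is not isomorphic to λ₁, and λ₁ + λ is not isomorphic to λ₁. -/
namespace Computons

/-- A computon `C` is not isomorphic to `L` when some morphism `L → C` is injective on ports and
misses, on ports, the image of a morphism from another computon. -/
theorem not_isomorphic_of_disjoint_ports {K L C : Computon} (α : Hom K C) (β : Hom L C)
    (hβ : Function.Injective β.fP)
    (hd : Disjoint (Set.range α.fP) (Set.range β.fP)) : ¬ Isomorphic C L := by
  rintro ⟨φ, ψ, -, hψφ, -⟩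
  have hφ : Function.Injective φ.fP :=
    (Function.leftInverse_iff_comp.mpr hψφ).injective
  have := L.finP
  have hsurj : Function.Surjective (φ.fP ∘ β.fP) :=
    Finite.surjective_of_injective (hφ.comp hβ)
  obtain ⟨p⟩ := K.neP
  obtain ⟨q, hq⟩ := hsurj (φ.fP (α.fP p))
  exact Set.disjoint_left.mp hd ⟨p, rfl⟩ ⟨q, hφ hq⟩

/-- Asynchronous parallelising does not satisfy the identity law:
for all computons λ and λ₁, λ + λ₁ is not isomorphic to λ₁, and λ₁ + λ is not
isomorphic to λ₁. -/
theorem async_no_identity (L L1 : Computon) :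
    (∀ (C : Computon) (β₁ : Hom L C) (β₂ : Hom L1 C), IsCoprodObj β₁ β₂ →
      ¬ Isomorphic C L1) ∧
    (∀ (C : Computon) (β₁ : Hom L1 C) (β₂ : Hom L C), IsCoprodObj β₁ β₂ →
      ¬ Isomorphic C L1) := by
  constructor
  · rintro C β₁ β₂ ⟨-, hβ₂, -, -, -, -, -, hd, -⟩
    exact not_isomorphic_of_disjoint_ports β₁ β₂ hβ₂.2.1 hd
  · rintro C β₁ β₂ ⟨hβ₁, -, -, -, -, -, -, hd, -⟩
    exact not_isomorphic_of_disjoint_ports β₂ β₁ hβ₁.2.1 hd.symm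

end Computons
end

section
/- Closed branching does not satisfy the identity law: for every b-diagram ρ with connected computons λ₂ and λ₃, the closed branching computon λ₂ ??_ρ λ₃ is not isomorphic to λ₃, and it is not isomorphic to λ₂. -/
namespace Computons

open Classical in
/-- Send every boundary port of `A` to its type, and every internal port to its image under `j`. -/
noncomputable def collapseBoundary (A : Computon) {S : Finset ℕ} (h : A.types ⊆ S) {X : Type}
    (j : A.P → X) (p : A.P) : S ⊕ X :=
  if p ∈ inports A ∪ outports A then Sum.inl ⟨A.c p, h (A.c_mem p)⟩ else Sum.inr (j p)

section collapseBoundary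

variable {A : Computon} {S : Finset ℕ} (h : A.types ⊆ S) {X : Type} (j : A.P → X)

theorem collapseBoundary_of_mem {p : A.P} (hp : p ∈ inports A ∪ outports A) :
    collapseBoundary A h j p = Sum.inl ⟨A.c p, h (A.c_mem p)⟩ :=
  if_pos hp

theorem collapseBoundary_of_notMem {p : A.P} (hp : p ∉ inports A ∪ outports A) :
    collapseBoundary A h j p = Sum.inr (j p) :=
  if_neg hp

theorem collapseBoundary_eq_inr {p : A.P} {x : X} (hx : collapseBoundary A h j p = Sum.inr x) :
    j p = x := by
  by_cases hp : p ∈ inports A ∪ outports A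
  · simp [collapseBoundary_of_mem h j hp] at hx
  · rw [collapseBoundary_of_notMem h j hp] at hx
    exact Sum.inr_injective hx

theorem elim_collapseBoundary (k : X → ℕ) (hk : ∀ p, k (j p) = A.c p) (p : A.P) :
    Sum.elim Subtype.val k (collapseBoundary A h j p) = A.c p := by
  by_cases hp : p ∈ inports A ∪ outports A
  · simp [collapseBoundary_of_mem h j hp]
  · simp [collapseBoundary_of_notMem h j hp, hk]

end collapseBoundary

/-- Port map of the left summand of `boundaryGluing`. -/
noncomputable abbrev glueLeft (A B : Computon) : A.P → ↥(A.types ∪ B.types) ⊕ (A.P ⊕ B.P) :=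
  collapseBoundary A Finset.subset_union_left Sum.inl

/-- Port map of the right summand of `boundaryGluing`. -/
noncomputable abbrev glueRight (A B : Computon) : B.P → ↥(A.types ∪ B.types) ⊕ (A.P ⊕ B.P) :=
  collapseBoundary B Finset.subset_union_right Sum.inr

theorem elim_glueLeft (A B : Computon) (p : A.P) :
    Sum.elim Subtype.val (Sum.elim A.c B.c) (glueLeft A B p) = A.c p :=
  elim_collapseBoundary _ _ (Sum.elim A.c B.c) (fun _ => rfl) p

theorem elim_glueRight (A B : Computon) (p : B.P) :
    Sum.elim Subtype.val (Sum.elim A.c B.c) (glueRight A B p) = B.c p :=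
  elim_collapseBoundary _ _ (Sum.elim A.c B.c) (fun _ => rfl) p

theorem glueLeft_eq_inr {A B : Computon} {p : A.P} {x : A.P ⊕ B.P}
    (h : glueLeft A B p = Sum.inr x) : Sum.inl p = x :=
  collapseBoundary_eq_inr Finset.subset_union_left Sum.inl h

theorem glueRight_eq_inr {A B : Computon} {p : B.P} {x : A.P ⊕ B.P}
    (h : glueRight A B p = Sum.inr x) : Sum.inr p = x :=
  collapseBoundary_eq_inr Finset.subset_union_right Sum.inr h

/-- The computon obtained from `A` and `B` by identifying all boundary ports of equal type, with
a disjoint copy of the original ports added; the copies of the boundary ports are isolated. -/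
noncomputable def boundaryGluing (A B : Computon) : Computon where
  U := A.U ⊕ B.U
  P := ↥(A.types ∪ B.types) ⊕ (A.P ⊕ B.P)
  I := A.I ⊕ B.I
  O := A.O ⊕ B.O
  finU := by have := A.finU; have := B.finU; infer_instance
  finP := by have := A.finP; have := B.finP; infer_instance
  finI := by have := A.finI; have := B.finI; infer_instance
  finO := by have := A.finO; have := B.finO; infer_instance
  neP := ⟨Sum.inr (Sum.inl A.neP.some)⟩
  types := A.types ∪ B.types
  B := A.B ∪ B.B
  sigma := Sum.map A.sigma B.sigma
  t := Sum.elim (glueLeft A B ∘ A.t) (glueRight A B ∘ B.t)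
  tau := Sum.map A.tau B.tau
  s := Sum.elim (glueLeft A B ∘ A.s) (glueRight A B ∘ B.s)
  c := Sum.elim Subtype.val (Sum.elim A.c B.c)
  r := Sum.map A.r B.r
  f := Sum.elim A.f B.f
  c_mem := by
    rintro (p | p | p)
    · exact p.2
    · exact Finset.mem_union_left _ (A.c_mem p)
    · exact Finset.mem_union_right _ (B.c_mem p)
  f_mem := by
    rintro (o | o)
    · exact Finset.mem_union_left _ (A.f_mem o)
    · exact Finset.mem_union_right _ (B.f_mem o)
  sigma_surj := Sum.map_surjective.2 ⟨A.sigma_surj, B.sigma_surj⟩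
  tau_surj := Sum.map_surjective.2 ⟨A.tau_surj, B.tau_surj⟩
  r_surj := Sum.map_surjective.2 ⟨A.r_surj, B.r_surj⟩
  zero_mem := Finset.mem_union_left _ A.zero_mem
  tau_ctrl := by
    rintro (u | u)
    · obtain ⟨i, hi, rfl⟩ := A.tau_ctrl u
      exact ⟨Sum.inl i, (elim_glueLeft A B _).trans hi, rfl⟩
    · obtain ⟨i, hi, rfl⟩ := B.tau_ctrl u
      exact ⟨Sum.inr i, (elim_glueRight A B _).trans hi, rfl⟩
  sigma_ctrl := by
    rintro (u | u)
    · obtain ⟨o, ho, rfl⟩ := A.sigma_ctrl u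
      exact ⟨Sum.inl o, (elim_glueLeft A B _).trans ho, rfl⟩
    · obtain ⟨o, ho, rfl⟩ := B.sigma_ctrl u
      exact ⟨Sum.inr o, (elim_glueRight A B _).trans ho, rfl⟩
  sigma_r := by
    rintro (i | i)
    · exact congrArg Sum.inl (A.sigma_r i)
    · exact congrArg Sum.inr (B.sigma_r i)
  ctrl_inport := by
    obtain ⟨p, hp, hc⟩ := A.ctrl_inport
    refine ⟨Sum.inr (Sum.inl p), ?_, hc⟩
    rintro ⟨o | o, ho⟩
    · exact hp ⟨o, Sum.inl_injective (glueLeft_eq_inr ho)⟩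
    · exact Sum.inr_ne_inl (glueRight_eq_inr ho)
  ctrl_outport := by
    obtain ⟨p, hp, hc⟩ := A.ctrl_outport
    refine ⟨Sum.inr (Sum.inl p), ?_, hc⟩
    rintro ⟨i | i, hi⟩
    · exact hp ⟨i, Sum.inl_injective (glueLeft_eq_inr hi)⟩
    · exact Sum.inr_ne_inl (glueRight_eq_inr hi)

/-- The left inclusion into `boundaryGluing A B`. -/
noncomputable def gluingInl (A B : Computon) : Hom A (boundaryGluing A B) where
  fU := Sum.inl
  fP := glueLeft A B
  fI := Sum.inl
  fO := Sum.inl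
  typesSub := Finset.subset_union_left
  bSub := Finset.subset_union_left
  comm_tau _ := rfl
  comm_sigma _ := rfl
  comm_s _ := rfl
  comm_t _ := rfl
  comm_c := elim_glueLeft A B
  comm_r _ := rfl
  comm_f _ := rfl
  boundary := by
    intro p hp
    by_contra hb
    rw [glueLeft, collapseBoundary_of_notMem _ _ hb] at hp
    rcases hp with ⟨_, ⟨o | o, ho, rfl⟩, hu⟩ | ⟨_, ⟨i | i, hi, rfl⟩, hu⟩
    · exact hu ⟨_, ⟨o, Sum.inl_injective (glueLeft_eq_inr ho), rfl⟩, rfl⟩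
    · exact Sum.inr_ne_inl (glueRight_eq_inr ho)
    · exact hu ⟨_, ⟨i, Sum.inl_injective (glueLeft_eq_inr hi), rfl⟩, rfl⟩
    · exact Sum.inr_ne_inl (glueRight_eq_inr hi)

/-- The right inclusion into `boundaryGluing A B`. -/
noncomputable def gluingInr (A B : Computon) : Hom B (boundaryGluing A B) where
  fU := Sum.inr
  fP := glueRight A B
  fI := Sum.inr
  fO := Sum.inr
  typesSub := Finset.subset_union_right
  bSub := Finset.subset_union_right
  comm_tau _ := rfl
  comm_sigma _ := rfl
  comm_s _ := rfl
  comm_t _ := rfl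
  comm_c := elim_glueRight A B
  comm_r _ := rfl
  comm_f _ := rfl
  boundary := by
    intro p hp
    by_contra hb
    rw [glueRight, collapseBoundary_of_notMem _ _ hb] at hp
    rcases hp with ⟨_, ⟨o | o, ho, rfl⟩, hu⟩ | ⟨_, ⟨i | i, hi, rfl⟩, hu⟩
    · exact Sum.inl_ne_inr (glueLeft_eq_inr ho)
    · exact hu ⟨_, ⟨o, Sum.inr_injective (glueRight_eq_inr ho), rfl⟩, rfl⟩
    · exact Sum.inl_ne_inr (glueLeft_eq_inr hi)
    · exact hu ⟨_, ⟨i, Sum.inr_injective (glueRight_eq_inr hi), rfl⟩, rfl⟩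

theorem Connected.nonempty_U {A : Computon} (hA : Connected A) : Nonempty A.U := by
  obtain ⟨p, hp, -⟩ := A.ctrl_inport
  obtain ⟨n, e, -⟩ := hA p (Or.inl hp)
  rcases e 0 with i | o
  · exact ⟨A.tau i⟩
  · exact ⟨A.sigma o⟩

/-- Morphisms out of a trivial computon hitting only boundary ports have a cocone in the
boundary gluing. -/
theorem commSq_boundaryGluing {T A B : Computon} (hT : IsTrivial T) (a : Hom T A) (b : Hom T B)
    (ha : ∀ p, a.fP p ∈ inports A ∪ outports A) (hb : ∀ p, b.fP p ∈ inports B ∪ outports B) :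
    CommSq a b (gluingInl A B) (gluingInr A B) := by
  obtain ⟨hU, hI, hO⟩ := hT
  refine ⟨funext hU.elim, funext fun p => ?_, funext hI.elim, funext hO.elim⟩
  change glueLeft A B (a.fP p) = glueRight A B (b.fP p)
  rw [glueLeft, glueRight, collapseBoundary_of_mem _ _ (ha p), collapseBoundary_of_mem _ _ (hb p)]
  simp only [a.comm_c, b.comm_c]

theorem IsPushout.exists_surjective_sum {T A B Q : Computon} {a : Hom T A} {b : Hom T B}
    {η₁ : Hom A Q} {η₂ : Hom B Q} (hQ : IsPushout a b η₁ η₂) (hT : IsTrivial T)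
    (ha : ∀ p, a.fP p ∈ inports A ∪ outports A) (hb : ∀ p, b.fP p ∈ inports B ∪ outports B) :
    ∃ d : Q.U → A.U ⊕ B.U, Function.Surjective d := by
  obtain ⟨δ, ⟨h₁, h₂⟩, -⟩ := hQ.2 _ _ _ (commSq_boundaryGluing hT a b ha hb)
  refine ⟨δ.fU, ?_⟩
  rintro (u | u)
  · exact ⟨η₁.fU u, congrFun h₁.1 u⟩
  · exact ⟨η₂.fU u, congrFun h₂.1 u⟩

theorem Isomorphic.natCard_U_eq {A B : Computon} (h : Isomorphic A B) :
    Nat.card A.U = Nat.card B.U := by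
  obtain ⟨φ, ψ, h₁, -, -, -, h₂, -⟩ := h
  exact Nat.card_congr ⟨φ.fU, ψ.fU, congrFun h₁, congrFun h₂⟩

theorem IsCoprodObj.isTrivial {A B C : Computon} {a : Hom A C} {b : Hom B C}
    (h : IsCoprodObj a b) (hA : IsTrivial A) (hB : IsTrivial B) : IsTrivial C := by
  obtain ⟨-, -, hU, -, hI, hO, -⟩ := h
  obtain ⟨_, _, _⟩ := hA
  obtain ⟨_, _, _⟩ := hB
  refine ⟨⟨fun x => ?_⟩, ⟨fun x => ?_⟩, ⟨fun x => ?_⟩⟩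
  · simpa using hU x
  · simpa using hI x
  · simpa using hO x

/-- A map out of a coproduct induced by an in-marker and an out-marker hits only boundary ports. -/
theorem IsCoprodObj.map_mem_boundary {L₀ L₁ T A : Computon} {ι₀ : Hom L₀ T} {ι₁ : Hom L₁ T}
    (hT : IsCoprodObj ι₀ ι₁) {m₀ : Hom L₀ A} {m₁ : Hom L₁ A} (hm₀ : InMarker m₀)
    (hm₁ : OutMarker m₁) {g : Hom T A} (hg₀ : CompEq g ι₀ m₀) (hg₁ : CompEq g ι₁ m₁) (p : T.P) :
    g.fP p ∈ inports A ∪ outports A := by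
  obtain ⟨-, -, -, hP, -⟩ := hT
  rcases hP p with ⟨x, rfl⟩ | ⟨x, rfl⟩
  · exact Or.inl (hm₀.2.2 ▸ ⟨x, (congrFun hg₀.2.1 x).symm⟩)
  · exact Or.inr (hm₁.2.2 ▸ ⟨x, (congrFun hg₁.2.1 x).symm⟩)

/-- Closed branching does not satisfy the identity law: for every
b-diagram ρ with connected computons λ₂ and λ₃, the closed branching computon
λ₂ ??_ρ λ₃ (the pushout λ₂ +_{λ₀+λ₁} λ₃) is isomorphic neither to λ₃ nor to λ₂. -/
theorem closed_branching_no_identity (L0 L1 L2 L3 : Computon)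
    (inM2 : Hom L0 L2) (inM3 : Hom L0 L3)
    (outM2 : Hom L1 L2) (outM3 : Hom L1 L3)
    (hIn2 : InMarker inM2) (hIn3 : InMarker inM3)
    (hOut2 : OutMarker outM2) (hOut3 : OutMarker outM3)
    (hC2 : Connected L2) (hC3 : Connected L3)
    (T : Computon) (ι₀ : Hom L0 T) (ι₁ : Hom L1 T) (hT : IsCoprodObj ι₀ ι₁)
    (g₂ : Hom T L2) (g₃ : Hom T L3)
    (hg₂ : CompEq g₂ ι₀ inM2 ∧ CompEq g₂ ι₁ outM2)
    (hg₃ : CompEq g₃ ι₀ inM3 ∧ CompEq g₃ ι₁ outM3)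
    (Q : Computon) (η₂ : Hom L2 Q) (η₃ : Hom L3 Q)
    (hQ : IsPushout g₂ g₃ η₂ η₃) :
    ¬ Isomorphic Q L3 ∧ ¬ Isomorphic Q L2 := by
  have := L2.finU
  have := L3.finU
  have := Q.finU
  have := hC2.nonempty_U
  have := hC3.nonempty_U
  obtain ⟨d, hd⟩ := hQ.exists_surjective_sum (hT.isTrivial hIn2.1 hOut2.1)
    (hT.map_mem_boundary hIn2 hOut2 hg₂.1 hg₂.2) (hT.map_mem_boundary hIn3 hOut3 hg₃.1 hg₃.2)
  have hcard := Nat.card_le_card_of_surjective d hd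
  rw [Nat.card_sum] at hcard
  have h₂ : 0 < Nat.card L2.U := Nat.card_pos
  have h₃ : 0 < Nat.card L3.U := Nat.card_pos
  refine ⟨fun h => ?_, fun h => ?_⟩ <;>
  · have := h.natCard_U_eq
    omega

end Computons
end
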